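/- arXiv:1504.06280 — 2 statements merged into one kernel-verified Lean document; each statement's English description precedes it below -/
import Mathlib

section
/- Assume p̄ = 1/2. For every distribution η on R, lim_{n→∞} E_η[V_1 | V_0 = n]/n = 1. Moreover there are constants C, c > 0 such that for every n ∈ ℕ and every distribution η on R, |E_η[V_1 | V_0 = n] − n − (1 + η·𝐫̃)| ≤ C e^{−cn}, where 𝐫̃ = (I − K + 2𝐩μD_pK)^{−1}(𝟏−𝐩) − 𝟏. -/
open MeasureTheory Filter Set Matrix ProbabilityTheory
open scoped Classical

noncomputable section

/-- `K` is a (row-)stochastic matrix. -/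
def IsStochastic {n : Type*} [Fintype n] (K : Matrix n n ℝ) : Prop :=
  (∀ i j, 0 ≤ K i j) ∧ ∀ i, ∑ j, K i j = 1

/-- `v` is a probability (row) vector. -/
def IsProbVec {n : Type*} [Fintype n] (v : n → ℝ) : Prop :=
  (∀ i, 0 ≤ v i) ∧ ∑ i, v i = 1

/-- `μ` is a stationary distribution for `K`, i.e. `μ K = μ`. -/
def IsStationaryDist {n : Type*} [Fintype n] (K : Matrix n n ℝ) (μ : n → ℝ) : Prop :=
  IsProbVec μ ∧ Matrix.vecMul μ K = μ

/-- `μ` is the unique stationary distribution of `K` (equivalent, for a finite chain, to `K`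
having a unique closed irreducible subset). -/
def HasUniqueStationaryDist {n : Type*} [Fintype n] (K : Matrix n n ℝ) (μ : n → ℝ) : Prop :=
  IsStationaryDist K μ ∧ ∀ μ' : n → ℝ, IsStationaryDist K μ' → μ' = μ

/-- The vector `𝐫 = (I − K + 2(𝟏−𝐩)μD_{1−p}K)⁻¹ 𝐩 − 𝟏` (critical case `p̄ = 1/2`). -/
def rvec {n : Type*} [Fintype n] [DecidableEq n] (K : Matrix n n ℝ) (μ p : n → ℝ) : n → ℝ :=
  Matrix.mulVec
    (1 - K + (2 : ℝ) •
        Matrix.vecMulVec (fun i => 1 - p i)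
          (Matrix.vecMul μ (Matrix.diagonal (fun i => 1 - p i) * K)))⁻¹ p
    - 1

/-- The parameter `ν = 2 + 4 μ D_p K 𝐫` (critical case `p̄ = 1/2`). -/
def nuVal {n : Type*} [Fintype n] [DecidableEq n] (K : Matrix n n ℝ) (μ p : n → ℝ) : ℝ :=
  2 + 4 * ∑ i, Matrix.vecMul μ (Matrix.diagonal p * K) i * rvec K μ p i

/-- The parameter `δ = 2 (η·𝐫) / ν` (critical case `p̄ = 1/2`). -/
def deltaVal {n : Type*} [Fintype n] [DecidableEq n] (K : Matrix n n ℝ) (μ p η : n → ℝ) : ℝ :=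
  2 * (∑ i, η i * rvec K μ p i) / nuVal K μ p

/-- `(Pm, Rc, ξ)` is the (averaged) law of the environment and coin tosses at a single site:
`Rc` is a Markov chain with transition matrix `K` and initial distribution `η`
(0-based indexing: `Rc j` is `R_{j+1}` of the paper) and, conditionally on the chain, the
`ξ j` are independent Bernoulli with success probability `p (Rc j)`. -/
def IsCookieSite {N : ℕ} {Ω : Type*} [MeasurableSpace Ω] (Pm : Measure Ω)
    (K : Matrix (Fin N) (Fin N) ℝ) (p η : Fin N → ℝ)
    (Rc : ℕ → Ω → Fin N) (ξ : ℕ → Ω → Bool) : Prop :=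
  (∀ j, Measurable (Rc j)) ∧ (∀ j, Measurable (ξ j)) ∧
    ∀ (m : ℕ) (f : ℕ → Fin N) (b : ℕ → Bool),
      (Pm {ω | ∀ j ≤ m, Rc j ω = f j ∧ ξ j ω = b j}).toReal =
        η (f 0) * (∏ j ∈ Finset.range m, K (f j) (f (j + 1))) *
          ∏ j ∈ Finset.range (m + 1), (if b j then p (f j) else 1 - p (f j))

/-- `numSucc ξx m` = number of successes before the `m`-th failure in the Bernoulli
sequence `ξx` (the quantity `S_m` of the paper). -/
def numSucc (ξx : ℕ → Bool) (m : ℕ) : ℕ :=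
  sInf {k | ((Finset.range (k + m)).filter fun j => ξx j = false).card = m}

/-- `numFail ξx m` = number of failures before the `m`-th success in the Bernoulli
sequence `ξx` (the quantity `F_m` of the paper). -/
def numFail (ξx : ℕ → Bool) (m : ℕ) : ℕ :=
  sInf {k | ((Finset.range (k + m)).filter fun j => ξx j = true).card = m}

/-- The forward branching-like process: `U_0 = y`, `U_i = S^i_{U_{i−1}}`. -/
def Uproc (ξ : ℤ → ℕ → Bool) (y : ℕ) : ℕ → ℕ
  | 0 => y
  | i + 1 => numSucc (ξ ((i : ℤ) + 1)) (Uproc ξ y i)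

/-- The backward branching-like process: `V_0 = y`, `V_i = F^i_{V_{i−1}+1}`. -/
def Vproc (ξ : ℤ → ℕ → Bool) (y : ℕ) : ℕ → ℕ
  | 0 => y
  | i + 1 => numFail (ξ ((i : ℤ) + 1)) (Vproc ξ y i + 1)

/-- Minimum principle for a strictly substochastic matrix. -/
lemma nonneg_of_mulVec_le {n : Type*} [Fintype n] {Q : Matrix n n ℝ}
    (hQ : ∀ i j, 0 ≤ Q i j) (hrow : ∀ i, ∑ j, Q i j < 1) {x : n → ℝ}
    (hx : ∀ i, (Q *ᵥ x) i ≤ x i) (i : n) : 0 ≤ x i := by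
  have : Nonempty n := ⟨i⟩
  obtain ⟨k, hk⟩ := Finite.exists_min x
  refine le_trans ?_ (hk i)
  by_contra! hneg
  have h1 : (∑ j, Q k j) * x k ≤ (Q *ᵥ x) k := by
    rw [Finset.sum_mul]
    exact Finset.sum_le_sum fun j _ => mul_le_mul_of_nonneg_left (hk j) (hQ k j)
  nlinarith [hx k, hrow k]

/-- `1 - Q` is invertible when `Q` is strictly substochastic. -/
lemma isUnit_one_sub_of_row_sum_lt {n : Type*} [Fintype n] [DecidableEq n] {Q : Matrix n n ℝ}
    (hQ : ∀ i j, 0 ≤ Q i j) (hrow : ∀ i, ∑ j, Q i j < 1) : IsUnit (1 - Q) := by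
  rw [← Matrix.mulVec_injective_iff_isUnit]
  have key : ∀ x : n → ℝ, (1 - Q) *ᵥ x = 0 → ∀ i, 0 ≤ x i := fun x hx i => by
    refine nonneg_of_mulVec_le hQ hrow (fun i => ?_) i
    have := congrFun hx i
    simp only [Matrix.sub_mulVec, Matrix.one_mulVec, Pi.sub_apply, Pi.zero_apply] at this
    linarith
  intro x y hxy
  have h1 : (1 - Q) *ᵥ (x - y) = 0 := by
    rw [Matrix.mulVec_sub, sub_eq_zero]; exact hxy
  have h2 : (1 - Q) *ᵥ (y - x) = 0 := by
    rw [Matrix.mulVec_sub, sub_eq_zero]; exact hxy.symm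
  ext i
  have h3 := key _ h1 i
  have h4 := key _ h2 i
  simp only [Pi.sub_apply] at h3 h4
  linarith

/-- The Green matrix of a strictly substochastic matrix is nonnegative. -/
lemma inv_one_sub_nonneg {n : Type*} [Fintype n] [DecidableEq n] {Q : Matrix n n ℝ}
    (hQ : ∀ i j, 0 ≤ Q i j) (hrow : ∀ i, ∑ j, Q i j < 1) (i j : n) : 0 ≤ (1 - Q)⁻¹ i j := by
  have hdet := (Matrix.isUnit_iff_isUnit_det _).1 (isUnit_one_sub_of_row_sum_lt hQ hrow)
  have h := nonneg_of_mulVec_le hQ hrow (x := (1 - Q)⁻¹ *ᵥ Pi.single j 1) (fun k => ?_) i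
  · simpa using h
  · have h1 : (1 - Q) *ᵥ ((1 - Q)⁻¹ *ᵥ Pi.single j 1) = Pi.single j 1 := by
      rw [Matrix.mulVec_mulVec, Matrix.mul_nonsing_inv _ hdet, Matrix.one_mulVec]
    have h2 := congrFun h1 k
    rw [Matrix.sub_mulVec, Matrix.one_mulVec, Pi.sub_apply] at h2
    have h3 : (0 : ℝ) ≤ (Pi.single j 1 : n → ℝ) k := by
      by_cases hjk : k = j
      · subst hjk; simp
      · simp [hjk]
    linarith

lemma IsStochastic.mulVec_one {n : Type*} [Fintype n] {K : Matrix n n ℝ} (hK : IsStochastic K) :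
    K *ᵥ 1 = 1 := by
  ext i
  simpa [Matrix.mulVec, dotProduct] using hK.2 i

lemma IsProbVec.vecMul {n : Type*} [Fintype n] {K : Matrix n n ℝ} (hK : IsStochastic K)
    {v : n → ℝ} (hv : IsProbVec v) : IsProbVec (v ᵥ* K) := by
  refine ⟨fun j => Finset.sum_nonneg fun i _ => mul_nonneg (hv.1 i) (hK.1 i j), ?_⟩
  have h : (v ᵥ* K) ⬝ᵥ 1 = v ⬝ᵥ 1 := by
    rw [← Matrix.dotProduct_mulVec, hK.mulVec_one]
  simpa [dotProduct, hv.2] using h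

/-- If the stationary distribution is unique, every state in its support is accessible from
every state. -/
lemma HasUniqueStationaryDist.exists_pow_ne_zero {n : Type*} [Fintype n] [DecidableEq n]
    {K : Matrix n n ℝ} {μ : n → ℝ} (hK : IsStochastic K) (hμ : HasUniqueStationaryDist K μ)
    {j : n} (hj : μ j ≠ 0) (i : n) : ∃ m : ℕ, (K ^ m) i j ≠ 0 := by
  by_contra! hzero
  set e : ℕ → n → ℝ := fun m => Pi.single i 1 ᵥ* K ^ m with he
  have he_succ : ∀ m, e m ᵥ* K = e (m + 1) := fun m => by
    simp only [he, Matrix.vecMul_vecMul, pow_succ]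
  have he_prob : ∀ m, IsProbVec (e m) := by
    intro m
    induction m with
    | zero =>
      have he0 : e 0 = Pi.single i 1 := by rw [he]; simp only [pow_zero, Matrix.vecMul_one]
      rw [he0]
      refine ⟨fun k => ?_, by simp⟩
      by_cases hk : k = i
      · subst hk; simp
      · simp [hk]
    | succ m ih => rw [← he_succ]; exact ih.vecMul hK
  set a : ℕ → n → ℝ := fun m => ((m : ℝ) + 1)⁻¹ • ∑ l ∈ Finset.range (m + 1), e l with ha
  have ha_mem : ∀ m, a m ∈ stdSimplex ℝ n := by
    intro m
    refine ⟨fun k => ?_, ?_⟩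
    · simp only [ha, Pi.smul_apply, Finset.sum_apply, smul_eq_mul]
      exact mul_nonneg (by positivity) (Finset.sum_nonneg fun l _ => (he_prob l).1 k)
    · simp only [ha, Pi.smul_apply, Finset.sum_apply, smul_eq_mul]
      rw [← Finset.mul_sum, Finset.sum_comm]
      simp only [(he_prob _).2, Finset.sum_const, Finset.card_range, nsmul_eq_mul]
      push_cast
      field_simp
  obtain ⟨ν, hν, φ, hφ, hlim⟩ := (isCompact_stdSimplex ℝ n).tendsto_subseq ha_mem
  have hdiff : ∀ m, a m ᵥ* K - a m = ((m : ℝ) + 1)⁻¹ • (e (m + 1) - e 0) := by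
    intro m
    simp only [ha, Matrix.smul_vecMul, Matrix.sum_vecMul, he_succ]
    rw [← smul_sub, ← Finset.sum_sub_distrib, Finset.sum_range_sub]
  have hle : ∀ v : n → ℝ, IsProbVec v → ∀ k, v k ≤ 1 := fun v hv k => by
    rw [← hv.2]; exact Finset.single_le_sum (fun l _ => hv.1 l) (Finset.mem_univ k)
  have hstat : ν ᵥ* K - ν = 0 := by
    have hcont : Continuous fun v : n → ℝ => v ᵥ* K - v :=
      (Continuous.matrix_vecMul continuous_id continuous_const).sub continuous_id
    have h1 := (hcont.tendsto ν).comp hlim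
    refine tendsto_nhds_unique h1 ?_
    have h2 : Tendsto (fun m => a m ᵥ* K - a m) atTop (nhds 0) := by
      rw [tendsto_pi_nhds]
      intro k
      have h3 : Tendsto (fun m : ℕ => ((m : ℝ) + 1)⁻¹) atTop (nhds 0) := by
        simpa [one_div] using tendsto_one_div_add_atTop_nhds_zero_nat (𝕜 := ℝ)
      refine squeeze_zero_norm (fun m => ?_) h3
      rw [hdiff, Pi.smul_apply, smul_eq_mul, norm_mul, Real.norm_eq_abs, Real.norm_eq_abs,
        abs_of_nonneg (by positivity : (0 : ℝ) ≤ ((m : ℝ) + 1)⁻¹)]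
      refine mul_le_of_le_one_right (by positivity) ?_
      rw [Pi.sub_apply, abs_le]
      constructor <;>
        linarith [(he_prob (m + 1)).1 k, (he_prob 0).1 k, hle _ (he_prob (m + 1)) k,
          hle _ (he_prob 0) k]
    exact h2.comp hφ.tendsto_atTop
  have hνμ := hμ.2 ν ⟨⟨hν.1, hν.2⟩, sub_eq_zero.1 hstat⟩
  apply hj
  rw [← hνμ]
  refine tendsto_nhds_unique ((tendsto_pi_nhds.1 hlim) j) ?_
  have : ∀ m, (a ∘ φ) m j = 0 := fun m => by
    simp [ha, he, hzero]
  simp [this]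

/-- Each step of a stochastic matrix with a column bounded below by `ε` contracts the oscillation
of a function by `1 - ε`. -/
lemma IsStochastic.exists_bounds_pow_mulVec {n : Type*} [Fintype n] [DecidableEq n]
    {P : Matrix n n ℝ} (hP : IsStochastic P) {ε : ℝ} {k : n} (hε : ∀ i, ε ≤ P i k)
    {f : n → ℝ} {a b : ℝ} (hf : ∀ i, a ≤ f i ∧ f i ≤ b) (m : ℕ) :
    ∃ a' b' : ℝ, (∀ i, a' ≤ (P ^ m *ᵥ f) i ∧ (P ^ m *ᵥ f) i ≤ b') ∧
      b' - a' = (1 - ε) ^ m * (b - a) := by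
  induction m with
  | zero => exact ⟨a, b, by simpa using hf, by simp⟩
  | succ m ih =>
    obtain ⟨a', b', h, hab⟩ := ih
    set g := P ^ m *ᵥ f
    have hg : P ^ (m + 1) *ᵥ f = P *ᵥ g := by
      rw [Matrix.mulVec_mulVec, pow_succ']
    have hsum : ∀ (i : n) (c : ℝ),
        ∑ j, P i j * (g j - c) = (P *ᵥ g) i - c := fun i c => by
      simp only [mul_sub, Finset.sum_sub_distrib, ← Finset.sum_mul, hP.2, one_mul]
      rfl
    refine ⟨ε * g k + (1 - ε) * a', ε * g k + (1 - ε) * b', fun i => ?_, ?_⟩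
    · rw [hg]
      constructor
      · have h1 : P i k * (g k - a') ≤ ∑ j, P i j * (g j - a') :=
          Finset.single_le_sum
            (fun j _ => mul_nonneg (hP.1 i j) (sub_nonneg.2 (h j).1)) (Finset.mem_univ k)
        rw [hsum] at h1
        nlinarith [hε i, (h k).1]
      · have h1 : -(P i k * (g k - b')) ≤ ∑ j, -(P i j * (g j - b')) :=
          Finset.single_le_sum
            (f := fun j => -(P i j * (g j - b')))
            (fun j _ => by nlinarith [hP.1 i j, (h j).2]) (Finset.mem_univ k)
        rw [Finset.sum_neg_distrib, hsum] at h1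
        nlinarith [hε i, (h k).2]
    · rw [pow_succ']
      linear_combination (1 - ε) * hab

/-- Geometric ergodicity of a stochastic matrix with a positive column. -/
lemma IsStochastic.exists_abs_pow_mulVec_sub_le {n : Type*} [Fintype n] [DecidableEq n]
    {P : Matrix n n ℝ} (hP : IsStochastic P) {ε : ℝ} {k : n} (hε : ∀ i, ε ≤ P i k)
    {π : n → ℝ} (hπ : IsStationaryDist P π) (f : n → ℝ) :
    ∃ B : ℝ, 0 < B ∧ ∀ (m : ℕ) (i : n),
      |(P ^ m *ᵥ f) i - π ⬝ᵥ f| ≤ B * (1 - ε) ^ m := by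
  set S := ∑ j, |f j| + 1 with hS
  have hS0 : 0 < S := by positivity
  have hfS : ∀ i, -S ≤ f i ∧ f i ≤ S := fun i => by
    rw [← abs_le]
    have := Finset.single_le_sum (f := fun j => |f j|) (fun j _ => abs_nonneg _)
      (Finset.mem_univ i)
    linarith
  refine ⟨S - -S, by linarith, fun m i => ?_⟩
  obtain ⟨a, b, hab, hlen⟩ := hP.exists_bounds_pow_mulVec hε hfS m
  have hinv : ∀ m : ℕ, π ᵥ* P ^ m = π := fun m => by
    induction m with
    | zero => simp
    | succ m ih => rw [pow_succ, ← Matrix.vecMul_vecMul, ih, hπ.2]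
  have hmean : π ⬝ᵥ (P ^ m *ᵥ f) = π ⬝ᵥ f := by rw [Matrix.dotProduct_mulVec, hinv]
  have hsum : ∀ c : ℝ, ∑ j, π j * c = c := fun c => by rw [← Finset.sum_mul, hπ.1.2, one_mul]
  have hlow : a ≤ π ⬝ᵥ f := by
    rw [← hmean, ← hsum a]
    exact Finset.sum_le_sum fun j _ => mul_le_mul_of_nonneg_left (hab j).1 (hπ.1.1 j)
  have hup : π ⬝ᵥ f ≤ b := by
    rw [← hmean, ← hsum b]
    exact Finset.sum_le_sum fun j _ => mul_le_mul_of_nonneg_left (hab j).2 (hπ.1.1 j)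
  rw [mul_comm, ← hlen, abs_le]
  constructor <;> linarith [(hab i).1, (hab i).2]

/-- The solution of the first-step equations for the mean number of failures before the `m`-th
success, with its exponentially precise asymptotics in the critical case. -/
lemma exists_mean_failures_profile {n : Type*} [Fintype n] [DecidableEq n]
    {K : Matrix n n ℝ} {μ p : n → ℝ} (hK : IsStochastic K) (hμ : HasUniqueStationaryDist K μ)
    (hp : ∀ i, p i ∈ Set.Ioo (0 : ℝ) 1) (hcrit : ∑ i, μ i * p i = 1 / 2) :
    ∃ h : ℕ → n → ℝ, h 0 = 0 ∧
      (∀ m i, h (m + 1) i =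
        (1 - p i) + (1 - p i) * (K *ᵥ h (m + 1)) i + p i * (K *ᵥ h m) i) ∧
      ∃ C c : ℝ, 0 < C ∧ 0 < c ∧ ∀ (m : ℕ) (i : n),
        |h (m + 1) i - m - (1 + rvec K μ (fun i' => 1 - p i') i)| ≤ C * Real.exp (-c * m) := by
  set q : n → ℝ := fun i => 1 - p i with hq
  set Q : Matrix n n ℝ := Matrix.diagonal q * K with hQdef
  set D : Matrix n n ℝ := Matrix.diagonal p * K with hDdef
  set w : n → ℝ := μ ᵥ* D with hw
  have hQD : 1 - Q = 1 - K + D := by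
    have : Q + D = K := by
      rw [hQdef, hDdef, ← add_mul, Matrix.diagonal_add]
      simp [hq]
    rw [← this]; abel
  have hD : ∀ f : n → ℝ, ∀ i, (D *ᵥ f) i = p i * (K *ᵥ f) i := fun f i => by
    rw [hDdef, ← Matrix.mulVec_mulVec, Matrix.mulVec_diagonal]
  have hQ : ∀ f : n → ℝ, ∀ i, (Q *ᵥ f) i = (1 - p i) * (K *ᵥ f) i := fun f i => by
    rw [hQdef, ← Matrix.mulVec_mulVec, Matrix.mulVec_diagonal]
  have hQnn : ∀ i j, 0 ≤ Q i j := fun i j => by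
    rw [hQdef, Matrix.diagonal_mul]
    exact mul_nonneg (sub_nonneg.2 (hp i).2.le) (hK.1 i j)
  have hDnn : ∀ i j, 0 ≤ D i j := fun i j => by
    rw [hDdef, Matrix.diagonal_mul]
    exact mul_nonneg (hp i).1.le (hK.1 i j)
  have hQrow : ∀ i, ∑ j, Q i j < 1 := fun i => by
    simp only [hQdef, Matrix.diagonal_mul, ← Finset.mul_sum, hK.2, hq]
    linarith [(hp i).1]
  have hdet := (Matrix.isUnit_iff_isUnit_det _).1 (isUnit_one_sub_of_row_sum_lt hQnn hQrow)
  set G := (1 - Q)⁻¹ with hG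
  have hGnn : ∀ i j, 0 ≤ G i j := inv_one_sub_nonneg hQnn hQrow
  have hGA : G * (1 - Q) = 1 := Matrix.nonsing_inv_mul _ hdet
  have hAG : (1 - Q) * G = 1 := Matrix.mul_nonsing_inv _ hdet
  set P := G * D with hPdef
  have hA1 : (1 - Q) *ᵥ 1 = p := by
    ext i
    rw [Matrix.sub_mulVec, Matrix.one_mulVec, Pi.sub_apply, hQ, hK.mulVec_one]
    simp
  have hGp : G *ᵥ p = 1 := by
    rw [← hA1, Matrix.mulVec_mulVec, hGA, Matrix.one_mulVec]
  have hD1 : D *ᵥ 1 = p := by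
    ext i
    rw [hD, hK.mulVec_one]; simp
  have hP : IsStochastic P := by
    refine ⟨fun i j => Finset.sum_nonneg fun k _ => mul_nonneg (hGnn i k) (hDnn k j),
      fun i => ?_⟩
    have h1 : P *ᵥ 1 = 1 := by rw [hPdef, ← Matrix.mulVec_mulVec, hD1, hGp]
    simpa [Matrix.mulVec, dotProduct] using congrFun h1 i
  have hμp : μ ⬝ᵥ p = 1 / 2 := hcrit
  have hμA : μ ᵥ* (1 - Q) = w := by
    rw [hQD, Matrix.vecMul_add, Matrix.vecMul_sub, Matrix.vecMul_one, hμ.1.2, sub_self, zero_add]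
  have hwP : w ᵥ* P = w := by
    have hwG : w ᵥ* G = μ := by rw [← hμA, Matrix.vecMul_vecMul, hAG, Matrix.vecMul_one]
    rw [hPdef, ← Matrix.vecMul_vecMul, hwG]
  have hstat : IsStationaryDist P ((2 : ℝ) • w) := by
    refine ⟨⟨fun j => ?_, ?_⟩, by rw [Matrix.smul_vecMul, hwP]⟩
    · exact mul_nonneg zero_le_two
        (Finset.sum_nonneg fun k _ => mul_nonneg (hμ.1.1.1 k) (hDnn k j))
    · have h1 : w ⬝ᵥ 1 = 1 / 2 := by rw [hw, ← Matrix.dotProduct_mulVec, hD1, hμp]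
      have h2 : ∑ j, w j = 1 / 2 := by simpa [dotProduct] using h1
      simp only [Pi.smul_apply, smul_eq_mul, ← Finset.mul_sum, h2]
      norm_num
  obtain ⟨k, ε, hε0, hε2, hε⟩ : ∃ (k : n) (ε : ℝ), 0 < ε ∧ ε ≤ 1 / 2 ∧ ∀ i, ε ≤ P i k := by
    obtain ⟨j, hj⟩ : ∃ j, μ j ≠ 0 := by
      by_contra! h0
      have := hμ.1.1.2
      simp [h0] at this
    obtain ⟨k, hk⟩ : ∃ k, K j k ≠ 0 := by
      by_contra! h0
      have := hK.2 j
      simp [h0] at this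
    have hGK : ∀ (m : ℕ) (i l : n), G i l = 0 → (K ^ m) i l = 0 := by
      have hfix : G = 1 + G * Q := by
        rw [← hGA, mul_sub, mul_one, sub_add_cancel]
      have hentry : ∀ i l, G i l = (1 : Matrix n n ℝ) i l + ∑ t, G i t * Q t l := fun i l => by
        conv_lhs => rw [hfix]
        rfl
      have hone : ∀ i l, 0 ≤ (1 : Matrix n n ℝ) i l := fun i l => by
        rw [Matrix.one_apply]; split_ifs <;> simp
      have hsum_nn : ∀ i l, 0 ≤ ∑ t, G i t * Q t l := fun i l =>
        Finset.sum_nonneg fun t _ => mul_nonneg (hGnn i t) (hQnn t l)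
      intro m
      induction m with
      | zero =>
        intro i l h0
        rw [pow_zero]
        linarith [hentry i l, hone i l, hsum_nn i l]
      | succ m ih =>
        intro i l h0
        have h1 : ∑ t, G i t * Q t l = 0 := by
          linarith [hentry i l, hone i l, hsum_nn i l]
        rw [Finset.sum_eq_zero_iff_of_nonneg
          fun t _ => mul_nonneg (hGnn i t) (hQnn t l)] at h1
        rw [pow_succ, Matrix.mul_apply]
        refine Finset.sum_eq_zero fun t ht => ?_
        rcases mul_eq_zero.1 (h1 t ht) with h2 | h2
        · rw [ih i t h2, zero_mul]
        · rw [hQdef, Matrix.diagonal_mul] at h2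
          rcases mul_eq_zero.1 h2 with h3 | h3
          · have := (hp t).2
            simp only [hq] at h3
            linarith
          · rw [h3, mul_zero]
    have hpos : ∀ i, 0 < P i k := fun i => by
      obtain ⟨m, hm⟩ := hμ.exists_pow_ne_zero hK hj i
      have hGpos : 0 < G i j := lt_of_le_of_ne (hGnn i j) fun h0 => hm (hGK m i j h0.symm)
      have hDpos : 0 < D j k := by
        rw [hDdef, Matrix.diagonal_mul]
        exact mul_pos (hp j).1 (lt_of_le_of_ne (hK.1 j k) hk.symm)
      refine lt_of_lt_of_le (mul_pos hGpos hDpos) ?_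
      exact Finset.single_le_sum (f := fun t => G i t * D t k)
        (fun t _ => mul_nonneg (hGnn i t) (hDnn t k)) (Finset.mem_univ j)
    have : Nonempty n := ⟨j⟩
    obtain ⟨i₀, hi₀⟩ := Finite.exists_min fun i => P i k
    exact ⟨k, min (P i₀ k) (1 / 2), lt_min (hpos i₀) (by norm_num), min_le_right _ _,
      fun i => (min_le_left _ _).trans (hi₀ i)⟩
  set M : Matrix n n ℝ := 1 - K + (2 : ℝ) • Matrix.vecMulVec p w with hM
  have hMmul : ∀ y : n → ℝ, M *ᵥ y = y - K *ᵥ y + (2 * (w ⬝ᵥ y)) • p := fun y => by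
    ext i
    simp only [hM, Matrix.add_mulVec, Matrix.sub_mulVec, Matrix.one_mulVec, Matrix.smul_mulVec,
      Matrix.vecMulVec_mulVec, Pi.add_apply, Pi.sub_apply, Pi.smul_apply, smul_eq_mul,
      MulOpposite.smul_eq_mul_unop, MulOpposite.unop_op]
    ring
  have hμM : ∀ y : n → ℝ, μ ⬝ᵥ (M *ᵥ y) = w ⬝ᵥ y := fun y => by
    rw [hMmul, dotProduct_add, dotProduct_sub, dotProduct_smul, Matrix.dotProduct_mulVec, hμ.1.2,
      hμp, smul_eq_mul]
    ring
  have hAy : ∀ y z : n → ℝ, y - K *ᵥ y = z → y = P *ᵥ y + G *ᵥ z := fun y z hyz => by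
    have h1 : (1 - Q) *ᵥ y = D *ᵥ y + z := by
      rw [hQD, Matrix.add_mulVec, Matrix.sub_mulVec, Matrix.one_mulVec, hyz, add_comm]
    rw [hPdef, ← Matrix.mulVec_mulVec, ← Matrix.mulVec_add, ← h1, Matrix.mulVec_mulVec, hGA,
      Matrix.one_mulVec]
  have hMunit : IsUnit M := by
    rw [← Matrix.mulVec_injective_iff_isUnit]
    have key : ∀ y : n → ℝ, M *ᵥ y = 0 → y = 0 := fun y hy => by
      have hwy : w ⬝ᵥ y = 0 := by rw [← hμM, hy, dotProduct_zero]
      have hyK : y - K *ᵥ y = 0 := by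
        have := hMmul y
        rw [hy, hwy] at this
        simpa using this.symm
      have hyP : P *ᵥ y = y := by
        have := hAy y 0 hyK
        rw [Matrix.mulVec_zero, add_zero] at this
        exact this.symm
      have hpow : ∀ m : ℕ, P ^ m *ᵥ y = y := fun m => by
        induction m with
        | zero => simp
        | succ m ih => rw [pow_succ, ← Matrix.mulVec_mulVec, hyP, ih]
      obtain ⟨B, -, hBd⟩ := hP.exists_abs_pow_mulVec_sub_le hε hstat y
      ext i
      have hlim : Tendsto (fun m : ℕ => B * (1 - ε) ^ m) atTop (nhds 0) := by
        simpa using (tendsto_pow_atTop_nhds_zero_of_lt_one (by linarith : 0 ≤ 1 - ε)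
          (by linarith)).const_mul B
      have hle := ge_of_tendsto' hlim fun m => by
        have := hBd m i
        rw [hpow, smul_dotProduct, hwy, smul_zero, sub_zero] at this
        exact this
      exact abs_nonpos_iff.1 hle
    intro y z hyz
    rw [← sub_eq_zero]
    refine key _ ?_
    rw [Matrix.mulVec_sub, sub_eq_zero]
    exact hyz
  have hMdet := (Matrix.isUnit_iff_isUnit_det _).1 hMunit
  set x := M⁻¹ *ᵥ q with hx
  have hMx : M *ᵥ x = q := by
    rw [hx, Matrix.mulVec_mulVec, Matrix.mul_nonsing_inv _ hMdet, Matrix.one_mulVec]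
  have hrvec : rvec K μ q = x - 1 := by
    simp only [rvec, hx, hM, hq, hw, hDdef, sub_sub_cancel]
  have hqp : q = 1 - p := rfl
  have hwx : w ⬝ᵥ x = 1 / 2 := by
    rw [← hμM, hMx, hqp, dotProduct_sub, hμp]
    have : μ ⬝ᵥ (1 : n → ℝ) = 1 := by simpa [dotProduct] using hμ.1.1.2
    rw [this]; norm_num
  have hxK : x - K *ᵥ x = q - p := by
    have := hMmul x
    rw [hMx, hwx] at this
    norm_num at this
    rw [this, add_sub_cancel_right]
  have hxP : G *ᵥ q = x - P *ᵥ x + 1 := by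
    have := hAy x _ hxK
    rw [Matrix.mulVec_sub, hGp] at this
    nth_rw 1 [this]
    abel
  have hP1 : P *ᵥ 1 = 1 := hP.mulVec_one
  set h : ℕ → n → ℝ := fun m => (m : ℝ) • (1 : n → ℝ) + x - P ^ m *ᵥ x with hh
  refine ⟨h, by simp [hh], fun m i => ?_, ?_⟩
  · have h1 : h (m + 1) = G *ᵥ q + P *ᵥ h m := by
      simp only [hh, Matrix.mulVec_sub, Matrix.mulVec_add, Matrix.mulVec_smul, hP1, hxP,
        Matrix.mulVec_mulVec, ← pow_succ']
      push_cast
      rw [add_smul, one_smul]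
      abel
    have h2 : (1 - Q) *ᵥ h (m + 1) = q + D *ᵥ h m := by
      rw [h1, Matrix.mulVec_add, Matrix.mulVec_mulVec, hAG, Matrix.one_mulVec, hPdef,
        Matrix.mulVec_mulVec, ← mul_assoc, hAG, one_mul]
    have h3 := congrFun h2 i
    rw [Matrix.sub_mulVec, Matrix.one_mulVec, Pi.sub_apply, Pi.add_apply, hQ, hD] at h3
    have h4 : q i = 1 - p i := rfl
    linarith
  · obtain ⟨B, hB, hBd⟩ := hP.exists_abs_pow_mulVec_sub_le hε hstat x
    refine ⟨B, -Real.log (1 - ε), hB,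
      neg_pos.2 (Real.log_neg (by linarith) (by linarith)), fun m i => ?_⟩
    have h1 := hBd (m + 1) i
    rw [smul_dotProduct, hwx, smul_eq_mul, mul_one_div_cancel two_ne_zero] at h1
    have h2 : h (m + 1) i - m - (1 + rvec K μ q i) = -((P ^ (m + 1) *ᵥ x) i - 1) := by
      simp only [hrvec, hh, Pi.sub_apply, Pi.add_apply, Pi.smul_apply, Pi.one_apply, smul_eq_mul]
      push_cast
      ring
    rw [h2, abs_neg, neg_neg, mul_comm (Real.log _), Real.exp_nat_mul,
      Real.exp_log (by linarith)]
    refine h1.trans (mul_le_mul_of_nonneg_left ?_ hB.le)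
    exact pow_le_pow_of_le_one (by linarith) (by linarith) (Nat.le_succ m)

/-- Number of successes among the first `J` trials. -/
def succCount (b : ℕ → Bool) (J : ℕ) : ℕ :=
  ∑ t ∈ Finset.range J, if b t = true then 1 else 0

/-- Number of failures among the first `J` trials that occur before the `m`-th success. -/
def failCount (b : ℕ → Bool) (m J : ℕ) : ℕ :=
  ∑ t ∈ Finset.range J, if b t = false ∧ succCount b t < m then 1 else 0

lemma succCount_succ (b : ℕ → Bool) (J : ℕ) :
    succCount b (J + 1) = succCount b J + if b J = true then 1 else 0 :=
  Finset.sum_range_succ _ _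

lemma failCount_succ (b : ℕ → Bool) (m J : ℕ) :
    failCount b m (J + 1) =
      failCount b m J + if b J = false ∧ succCount b J < m then 1 else 0 :=
  Finset.sum_range_succ _ _

lemma succCount_mono (b : ℕ → Bool) : Monotone (succCount b) :=
  monotone_nat_of_le_succ fun J => by rw [succCount_succ]; exact Nat.le_add_right _ _

lemma failCount_mono (b : ℕ → Bool) (m : ℕ) : Monotone (failCount b m) :=
  monotone_nat_of_le_succ fun J => by rw [failCount_succ]; exact Nat.le_add_right _ _

/-- Once `m` successes have occurred, `failCount` has reached its final value `numFail b m`. -/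
lemma numFail_eq_failCount {b : ℕ → Bool} {m J : ℕ} (hJ : m ≤ succCount b J) :
    numFail b m = failCount b m J := by
  have hset : ∀ k, ((Finset.range (k + m)).filter fun j => b j = true).card =
      succCount b (k + m) := fun k => by rw [Finset.card_filter]; rfl
  have key : ∀ J, (succCount b J < m → failCount b m J + succCount b J = J) ∧
      (m ≤ succCount b J → numFail b m = failCount b m J) := by
    intro J
    induction J with
    | zero =>
      refine ⟨fun _ => by simp [failCount, succCount], fun h => ?_⟩
      obtain rfl : m = 0 := by simpa [succCount] using h
      have : numFail b 0 ≤ 0 := Nat.sInf_le (by simp)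
      simpa [failCount] using this
    | succ J ih =>
      rw [succCount_succ, failCount_succ]
      by_cases hm : m ≤ succCount b J
      · refine ⟨fun h => by omega, fun _ => ?_⟩
        rw [if_neg (by omega), add_zero, ih.2 hm]
      · push Not at hm
        have h1 := ih.1 hm
        cases hb : b J
        · simp only [hm, Bool.false_eq_true, if_false, and_self, if_true]
          omega
        · simp only [Bool.true_eq_false, false_and, if_false, if_true, add_zero]
          refine ⟨fun _ => by omega, fun h2 => le_antisymm (Nat.sInf_le ?_) ?_⟩
          · have h3 : failCount b m J + m = J + 1 := by omega
            simp only [Set.mem_ofPred_eq, hset, h3, succCount_succ, hb, if_true]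
            omega
          · refine le_csInf ⟨failCount b m J, ?_⟩ fun k hk => ?_
            · have h3 : failCount b m J + m = J + 1 := by omega
              simp only [Set.mem_ofPred_eq, hset, h3, succCount_succ, hb, if_true]
              omega
            · simp only [Set.mem_ofPred_eq, hset] at hk
              by_contra! hlt
              have := succCount_mono b (show k + m ≤ J by omega)
              omega
  exact (key J).2 hJ

lemma integral_comp_eq_sum {Ω α : Type*} [MeasurableSpace Ω] {P : Measure Ω}
    [IsProbabilityMeasure P] [Fintype α] [MeasurableSpace α] [MeasurableSingletonClass α]
    {X : Ω → α} (hX : Measurable X) (g : α → ℝ) :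
    ∫ ω, g (X ω) ∂P = ∑ a, P.real (X ⁻¹' {a}) * g a := by
  have : IsProbabilityMeasure (P.map X) := Measure.isProbabilityMeasure_map hX.aemeasurable
  rw [← integral_map hX.aemeasurable (Measurable.of_discrete).aestronglyMeasurable,
    integral_fintype Integrable.of_finite]
  refine Finset.sum_congr rfl fun a _ => ?_
  rw [map_measureReal_apply hX (measurableSet_singleton a), smul_eq_mul]

namespace IsCookieSite

variable {N : ℕ} {Ω : Type*} [MeasurableSpace Ω] {P : Measure Ω} [IsProbabilityMeasure P]
  {K : Matrix (Fin N) (Fin N) ℝ} {p η : Fin N → ℝ} {Rc : ℕ → Ω → Fin N} {ξ : ℕ → Ω → Bool}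

lemma integrable_comp (hsite : IsCookieSite P K p η Rc ξ) (Φ : ℕ → Fin N → Bool → ℝ)
    (j k l : ℕ) :
    Integrable (fun ω => Φ (succCount (fun t => ξ t ω) j) (Rc k ω) (ξ l ω)) P := by
  set X : Ω → (Fin j → Bool) × Fin N × Bool := fun ω => (fun t => ξ t ω, Rc k ω, ξ l ω) with hX
  have hXm : Measurable X :=
    (measurable_pi_lambda _ fun t : Fin j => hsite.2.1 t).prodMk
      ((hsite.1 k).prodMk (hsite.2.1 l))
  have : IsProbabilityMeasure (P.map X) := Measure.isProbabilityMeasure_map hXm.aemeasurable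
  have h := (Integrable.of_finite (μ := P.map X)
    (f := fun x : (Fin j → Bool) × Fin N × Bool =>
      Φ (∑ t, if x.1 t = true then 1 else 0) x.2.1 x.2.2)).comp_measurable hXm
  refine h.congr (Eventually.of_forall fun ω => ?_)
  simp only [Function.comp, hX, succCount, Finset.sum_range]

lemma integral_zero (hsite : IsCookieSite P K p η Rc ξ) (φ : Fin N → Bool → ℝ) :
    ∫ ω, φ (Rc 0 ω) (ξ 0 ω) ∂P =
      ∑ i, η i * (p i * φ i true + (1 - p i) * φ i false) := by
  have hXm : Measurable fun ω => (Rc 0 ω, ξ 0 ω) := (hsite.1 0).prodMk (hsite.2.1 0)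
  rw [integral_comp_eq_sum (P := P) hXm fun z => φ z.1 z.2, Fintype.sum_prod_type]
  refine Finset.sum_congr rfl fun i _ => ?_
  have hcyl : ∀ c : Bool, P.real ((fun ω => (Rc 0 ω, ξ 0 ω)) ⁻¹' {(i, c)}) =
      η i * (if c = true then p i else 1 - p i) := fun c => by
    have h := hsite.2.2 0 (fun _ => i) (fun _ => c)
    simp only [Finset.range_zero, Finset.prod_empty, mul_one, zero_add, Finset.prod_range_one] at h
    rw [← h, Measure.real]
    congr 2
    ext ω
    simp
  rw [Fintype.sum_bool, hcyl, hcyl]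
  simp only [if_true, Bool.false_eq_true, if_false]
  ring

lemma integral_succ (hsite : IsCookieSite P K p η Rc ξ) (Φ : ℕ → Fin N → Bool → ℝ) (j : ℕ) :
    ∫ ω, Φ (succCount (fun t => ξ t ω) (j + 1)) (Rc (j + 1) ω) (ξ (j + 1) ω) ∂P =
      ∫ ω, ∑ i, K (Rc j ω) i *
        (p i * Φ (succCount (fun t => ξ t ω) (j + 1)) i true +
          (1 - p i) * Φ (succCount (fun t => ξ t ω) (j + 1)) i false) ∂P := by
  set H : Ω → Fin (j + 1) → Fin N × Bool := fun ω t => (Rc t ω, ξ t ω) with hH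
  set σ : (Fin (j + 1) → Fin N × Bool) → ℕ := fun h => ∑ t, if (h t).2 = true then 1 else 0
    with hσ
  have hσH : ∀ ω, succCount (fun t => ξ t ω) (j + 1) = σ (H ω) := fun ω => by
    simp only [hσ, hH, succCount, Finset.sum_range]
  have hHm : Measurable H :=
    measurable_pi_lambda _ fun t => (hsite.1 t).prodMk (hsite.2.1 t)
  have hXm : Measurable fun ω => (H ω, (Rc (j + 1) ω, ξ (j + 1) ω)) :=
    hHm.prodMk ((hsite.1 _).prodMk (hsite.2.1 _))
  have hL := integral_comp_eq_sum (P := P) hXm fun z => Φ (σ z.1) z.2.1 z.2.2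
  have hR := integral_comp_eq_sum (P := P) hHm fun h => ∑ i, K (h (Fin.last j)).1 i *
        (p i * Φ (σ h) i true + (1 - p i) * Φ (σ h) i false)
  simp only [hσH]
  refine hL.trans (Eq.trans ?_ hR.symm)
  rw [Fintype.sum_prod_type]
  refine Finset.sum_congr rfl fun h _ => ?_
  rw [Fintype.sum_prod_type, Finset.mul_sum]
  refine Finset.sum_congr rfl fun i _ => ?_
  have hcyl : ∀ c : Bool,
      P.real ((fun ω => (H ω, (Rc (j + 1) ω, ξ (j + 1) ω))) ⁻¹' {(h, (i, c))}) =
        P.real (H ⁻¹' {h}) *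
          (K (h (Fin.last j)).1 i * (if c = true then p i else 1 - p i)) := fun c => by
    set z : ℕ → Fin N × Bool := fun t => if ht : t < j + 1 then h ⟨t, ht⟩ else (i, c) with hz
    have hzlt : ∀ t : Fin (j + 1), z t = h t := fun t => dif_pos t.2
    have hzj : z j = h (Fin.last j) := hzlt (Fin.last j)
    have hzs : z (j + 1) = (i, c) := by simp [hz]
    have hev : ∀ ω, H ω = h ↔ ∀ t ≤ j, Rc t ω = (z t).1 ∧ ξ t ω = (z t).2 := fun ω => by
      rw [funext_iff]
      constructor
      · intro hω t ht
        have h1 := hω ⟨t, Nat.lt_succ_of_le ht⟩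
        rw [← hzlt] at h1
        exact Prod.ext_iff.1 h1
      · intro hω t
        rw [← hzlt]
        exact Prod.ext_iff.2 (hω t (Nat.le_of_lt_succ t.2))
    have h1 := hsite.2.2 j (fun t => (z t).1) (fun t => (z t).2)
    have h2 := hsite.2.2 (j + 1) (fun t => (z t).1) (fun t => (z t).2)
    have e1 : H ⁻¹' {h} = {ω | ∀ t ≤ j, Rc t ω = (z t).1 ∧ ξ t ω = (z t).2} := by
      ext ω; exact hev ω
    have e2 : (fun ω => (H ω, (Rc (j + 1) ω, ξ (j + 1) ω))) ⁻¹' {(h, (i, c))} =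
        {ω | ∀ t ≤ j + 1, Rc t ω = (z t).1 ∧ ξ t ω = (z t).2} := by
      ext ω
      simp only [Set.mem_preimage, Set.mem_singleton_iff, Prod.mk.injEq, Set.mem_ofPred_eq, hev]
      constructor
      · rintro ⟨ha, hb⟩ t ht
        rcases Nat.le_succ_iff.1 ht with ht | rfl
        · exact ha t ht
        · rw [hzs]; exact hb
      · intro ha
        refine ⟨fun t ht => ha t (ht.trans (Nat.le_succ j)), ?_⟩
        have := ha (j + 1) le_rfl
        rwa [hzs] at this
    rw [Measure.real, Measure.real, e1, e2, h1, h2, Finset.prod_range_succ _ j,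
      Finset.prod_range_succ _ (j + 1)]
    simp only [hzs, hzj]
    ring
  rw [Fintype.sum_bool, hcyl, hcyl]
  simp only [if_true, Bool.false_eq_true, if_false]
  ring

/-- The mean of `numFail` solves the first-step equations: any family `h` with `h 0 = 0`
satisfying them gives the expected number of failures before the `m`-th success. -/
lemma integral_numFail (hsite : IsCookieSite P K p η Rc ξ) (hK : IsStochastic K)
    (hp : ∀ i, p i ∈ Set.Ioo (0 : ℝ) 1) {h : ℕ → Fin N → ℝ} (h0 : h 0 = 0)
    (hrec : ∀ m i, h (m + 1) i =
      (1 - p i) + (1 - p i) * (K *ᵥ h (m + 1)) i + p i * (K *ᵥ h m) i) (m : ℕ) :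
    ∫ ω, (numFail (fun t => ξ t ω) m : ℝ) ∂P = ∑ i, η i * h m i := by
  set S : ℕ → Ω → ℕ := fun J ω => succCount (fun t => ξ t ω) J with hS
  set I : ℕ → ℝ := fun J => ∫ ω, (if ξ J ω = false ∧ S J ω < m then (1 : ℝ) else 0) ∂P with hI
  set A : ℕ → ℝ := fun J => ∫ ω, (if S J ω < m then (1 : ℝ) else 0) ∂P with hA
  set Γ : ℕ → ℝ := fun J => ∫ ω, (K *ᵥ h (m - S (J + 1) ω)) (Rc J ω) ∂P with hΓ
  have hIint : ∀ J, Integrable (fun ω => if ξ J ω = false ∧ S J ω < m then (1 : ℝ) else 0) P :=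
    fun J => hsite.integrable_comp
      (fun s _ b => if b = false ∧ s < m then (1 : ℝ) else 0) J 0 J
  have hAint : ∀ J, Integrable (fun ω => if S J ω < m then (1 : ℝ) else 0) P :=
    fun J => hsite.integrable_comp (fun s _ _ => if s < m then (1 : ℝ) else 0) J 0 0
  have hΓint : ∀ J, Integrable (fun ω => (K *ᵥ h (m - S (J + 1) ω)) (Rc J ω)) P :=
    fun J => hsite.integrable_comp (fun s i _ => (K *ᵥ h (m - s)) i) (J + 1) J 0
  have hK0 : ∀ i, (K *ᵥ h 0) i = 0 := fun i => by rw [h0, Matrix.mulVec_zero]; rfl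
  have hstep : ∀ s i, p i * (K *ᵥ h (m - (s + 1))) i +
      (1 - p i) * ((if s < m then (1 : ℝ) else 0) + (K *ᵥ h (m - s)) i) = h (m - s) i := by
    intro s i
    by_cases hs : s < m
    · obtain ⟨d, rfl⟩ := Nat.exists_eq_add_of_lt hs
      rw [if_pos hs, show s + d + 1 - (s + 1) = d by omega, show s + d + 1 - s = d + 1 by omega,
        hrec d i]
      ring
    · rw [if_neg hs, show m - (s + 1) = 0 by omega, show m - s = 0 by omega, hK0, h0]
      simp
  set Ψ : ℕ → Fin N → Bool → ℝ := fun s i b =>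
    (if b = false ∧ s < m then (1 : ℝ) else 0) +
      (K *ᵥ h (m - (s + if b = true then 1 else 0))) i with hΨ
  have hΨt : ∀ s i, Ψ s i true = (K *ᵥ h (m - (s + 1))) i := fun s i => by simp [hΨ]
  have hΨf : ∀ s i, Ψ s i false = (if s < m then (1 : ℝ) else 0) + (K *ᵥ h (m - s)) i :=
    fun s i => by simp [hΨ]
  have hIΓ : ∀ J, I J + Γ J = ∫ ω, Ψ (S J ω) (Rc J ω) (ξ J ω) ∂P := fun J => by
    rw [hI, hΓ, ← integral_add (hIint J) (hΓint J)]
    refine integral_congr_ae (Eventually.of_forall fun ω => ?_)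
    simp only [hΨ, hS, succCount_succ]
  have hinit : I 0 + Γ 0 = ∑ i, η i * h m i := by
    rw [hIΓ]
    have hz := hsite.integral_zero (Ψ 0)
    simp only [hΨt, hΨf, hstep] at hz
    rw [Nat.sub_zero] at hz
    rw [← hz]
    simp [hS, succCount]
  have hsucc : ∀ J, I (J + 1) + Γ (J + 1) = Γ J := fun J => by
    rw [hIΓ]
    have hz := hsite.integral_succ Ψ J
    simp only [hΨt, hΨf, hstep] at hz
    exact hz
  have hdynkin : ∀ J, ∑ t ∈ Finset.range (J + 1), I t + Γ J = ∑ i, η i * h m i := fun J => by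
    induction J with
    | zero => simpa using hinit
    | succ J ih => rw [Finset.sum_range_succ, ← ih]; linarith [hsucc J]
  obtain ⟨B, hB0, hB⟩ : ∃ B : ℝ, 0 ≤ B ∧ ∀ s i, |(K *ᵥ h (m - s)) i| ≤
      B * (if s + 1 ≤ m then 1 else 0) := by
    refine ⟨∑ l ∈ Finset.range (m + 1), ∑ i, |(K *ᵥ h l) i|, by positivity, fun s i => ?_⟩
    by_cases hs : s + 1 ≤ m
    · rw [if_pos hs, mul_one]
      refine le_trans ?_ (Finset.single_le_sum (f := fun l => ∑ i, |(K *ᵥ h l) i|)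
        (fun l _ => Finset.sum_nonneg fun _ _ => abs_nonneg _)
        (Finset.mem_range.2 (by omega : m - s < m + 1)))
      exact Finset.single_le_sum (f := fun i => |(K *ᵥ h (m - s)) i|)
        (fun _ _ => abs_nonneg _) (Finset.mem_univ i)
    · rw [if_neg hs, show m - s = 0 by omega, hK0]
      simp
  have hΓA : ∀ J, |Γ J| ≤ B * A (J + 1) := fun J => by
    rw [← Real.norm_eq_abs, hA, ← integral_const_mul]
    refine norm_integral_le_of_norm_le ((hAint (J + 1)).const_mul B)
      (Eventually.of_forall fun ω => ?_)
    exact hB (S (J + 1) ω) (Rc J ω)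
  have hA1 : ∀ J, A J ≤ 1 := fun J => by
    have h1 : A J ≤ ∫ _, (1 : ℝ) ∂P :=
      integral_mono (hAint J) (integrable_const 1) fun ω => by
        dsimp only
        split_ifs <;> norm_num
    simpa using h1
  have hAnn : ∀ J, 0 ≤ A J := fun J =>
    integral_nonneg fun ω => by dsimp only [Pi.zero_apply]; split_ifs <;> norm_num
  obtain ⟨c, hc0, hc⟩ : ∃ c : ℝ, 0 < c ∧ ∀ i, c ≤ 1 - p i := by
    rcases isEmpty_or_nonempty (Fin N) with hN | hN
    · exact ⟨1, one_pos, fun i => hN.elim i⟩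
    · obtain ⟨i₀, hi₀⟩ := Finite.exists_min fun i => 1 - p i
      exact ⟨1 - p i₀, sub_pos.2 (hp i₀).2, hi₀⟩
  have hAI : ∀ J, c * A (J + 1) ≤ I (J + 1) := fun J => by
    have hz := hsite.integral_succ (fun s _ b => if b = false ∧ s < m then (1 : ℝ) else 0) J
    simp only [Bool.true_eq_false, false_and, if_false, true_and, mul_zero, zero_add] at hz
    rw [hI]
    refine le_of_le_of_eq ?_ hz.symm
    rw [hA, ← integral_const_mul]
    refine integral_mono ((hAint (J + 1)).const_mul c)
      (hsite.integrable_comp (fun s r _ => ∑ i, K r i *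
        ((1 - p i) * (if s < m then (1 : ℝ) else 0))) (J + 1) J 0) fun ω => ?_
    have h1 : c * (if S (J + 1) ω < m then (1 : ℝ) else 0) =
        ∑ i, K (Rc J ω) i * (c * (if S (J + 1) ω < m then (1 : ℝ) else 0)) := by
      rw [← Finset.sum_mul, hK.2, one_mul]
    dsimp only
    rw [h1]
    refine Finset.sum_le_sum fun i _ => mul_le_mul_of_nonneg_left
      (mul_le_mul_of_nonneg_right (hc i) ?_) (hK.1 _ _)
    split_ifs <;> norm_num
  have hInn : ∀ J, 0 ≤ I J := fun J =>
    integral_nonneg fun ω => by dsimp only [Pi.zero_apply]; split_ifs <;> norm_num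
  have hIsum : Summable I := by
    refine summable_of_sum_range_le (c := ∑ i, η i * h m i + B) hInn fun J => ?_
    have h1 := hdynkin J
    rw [Finset.sum_range_succ] at h1
    have h2 := abs_le.1 (hΓA J)
    nlinarith [hInn J, hA1 (J + 1)]
  have hIlim : Tendsto (fun J => I (J + 1)) atTop (nhds 0) :=
    hIsum.tendsto_atTop_zero.comp (tendsto_add_atTop_nat 1)
  have hAlim : Tendsto (fun J => A (J + 1)) atTop (nhds 0) := by
    refine squeeze_zero (fun J => hAnn _) (fun J => ?_) (by simpa using hIlim.const_mul c⁻¹)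
    rw [inv_mul_eq_div, le_div_iff₀' hc0]
    exact hAI J
  have hΓlim : Tendsto Γ atTop (nhds 0) :=
    squeeze_zero_norm hΓA (by simpa using hAlim.const_mul B)
  set T : ℕ → Ω → ℝ := fun J ω => (failCount (fun t => ξ t ω) m J : ℝ) with hT
  have hTeq : ∀ J, T J = fun ω => ∑ t ∈ Finset.range J,
      (if ξ t ω = false ∧ S t ω < m then (1 : ℝ) else 0) := fun J => by
    ext ω
    simp [hT, failCount, hS]
  have hTint : ∀ J, Integrable (T J) P := fun J => by
    rw [hTeq]; exact integrable_finsetSum _ fun t _ => hIint t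
  have hTmean : ∀ J, ∫ ω, T J ω ∂P = ∑ t ∈ Finset.range J, I t := fun J => by
    rw [hTeq]; exact integral_finsetSum _ fun t _ => hIint t
  have hTlim : Tendsto (fun J => ∫ ω, T J ω ∂P) atTop (nhds (∑ i, η i * h m i)) := by
    rw [← tendsto_add_atTop_iff_nat 1]
    have h1 := hΓlim.const_sub (∑ i, η i * h m i)
    rw [sub_zero] at h1
    refine h1.congr fun J => ?_
    rw [hTmean, ← hdynkin J, add_sub_cancel_right]
  have hSm : ∀ J, Measurable (S J) := fun J =>
    Finset.measurable_sum _ fun t _ =>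
      (Measurable.of_discrete (f := fun b : Bool => if b = true then 1 else 0)).comp (hsite.2.1 t)
  have hae : ∀ᵐ ω ∂P, ∃ J, m ≤ S J ω := by
    have hle : ∀ J, P.real {ω | ¬ ∃ J, m ≤ S J ω} ≤ A J := fun J => by
      have hmeas : MeasurableSet {ω | S J ω < m} := hSm J measurableSet_Iio
      have h1 : A J = P.real {ω | S J ω < m} := by
        rw [← integral_indicator_one hmeas]
        refine integral_congr_ae (Eventually.of_forall fun ω => ?_)
        simp [Set.indicator_apply]
      rw [h1]
      refine measureReal_mono fun ω hω => ?_
      simp only [Set.mem_ofPred_eq, not_exists, not_le] at hω ⊢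
      exact hω J
    have h0 := ge_of_tendsto' hAlim fun J => hle (J + 1)
    rw [ae_iff]
    exact (measureReal_eq_zero_iff).1 (le_antisymm h0 measureReal_nonneg)
  have hconv : ∀ᵐ ω ∂P, Tendsto (fun J => T J ω) atTop
      (nhds (numFail (fun t => ξ t ω) m : ℝ)) := by
    filter_upwards [hae] with ω ⟨J₀, hJ₀⟩
    refine tendsto_const_nhds.congr' ?_
    filter_upwards [eventually_ge_atTop J₀] with J hJ
    simp only [hT]
    rw [numFail_eq_failCount (hJ₀.trans (succCount_mono _ hJ))]
  have hlint := lintegral_tendsto_of_tendsto_of_monotone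
    (fun J => (hTint J).aemeasurable.ennreal_ofReal)
    (Eventually.of_forall fun ω J J' hJ =>
      ENNReal.ofReal_le_ofReal (Nat.cast_le.2 (failCount_mono _ m hJ)))
    (hconv.mono fun ω hω => (ENNReal.continuous_ofReal.tendsto _).comp hω)
  have hlint' := (ENNReal.continuous_ofReal.tendsto _).comp hTlim
  have heq := tendsto_nhds_unique hlint (hlint'.congr fun J =>
    ofReal_integral_eq_lintegral_ofReal (hTint J)
      (Eventually.of_forall fun ω => Nat.cast_nonneg _))
  have hmeas : AEMeasurable (fun ω => (numFail (fun t => ξ t ω) m : ℝ)) P :=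
    aemeasurable_of_tendsto_metrizable_ae atTop (fun J => (hTint J).aemeasurable) hconv
  rw [integral_eq_lintegral_of_nonneg_ae (Eventually.of_forall fun ω => Nat.cast_nonneg _)
    hmeas.aestronglyMeasurable, heq, ENNReal.toReal_ofReal]
  exact ge_of_tendsto' hTlim fun J => integral_nonneg fun ω => Nat.cast_nonneg _

end IsCookieSite

/-- **Proposition 4.1 (mean of the backward BLP, critical case `p̄ = 1/2`).**
For every initial distribution `η`, `E_η[V₁ | V₀ = n]/n → 1`, and there are constants
`C, c > 0`, uniform in `η`, with `|E_η[V₁ | V₀ = n] − n − (1 + η·𝐫̃)| ≤ C e^{−cn}` for all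
`n`, where `𝐫̃ = (I − K + 2𝐩μD_pK)⁻¹(𝟏−𝐩) − 𝟏`. Here `V₁ = F_{n+1}` is the number of
failures before the `(n+1)`-st success at a site. Note `𝐫̃ = rvec K μ (1−p)`. -/
theorem backward_BLP_mean_asymptotics
    {N : ℕ} {Ω : Type*} [MeasurableSpace Ω]
    (K : Matrix (Fin N) (Fin N) ℝ) (μ p : Fin N → ℝ)
    (Rc : ℕ → Ω → Fin N) (ξ : ℕ → Ω → Bool)
    (Pfam : (Fin N → ℝ) → Measure Ω)
    (hK : IsStochastic K) (hμ : HasUniqueStationaryDist K μ)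
    (hp : ∀ i, p i ∈ Set.Ioo (0 : ℝ) 1)
    (hcrit : ∑ i, μ i * p i = 1 / 2)
    (henv : ∀ η : Fin N → ℝ, IsProbVec η →
      IsProbabilityMeasure (Pfam η) ∧ IsCookieSite (Pfam η) K p η Rc ξ) :
    (∀ η : Fin N → ℝ, IsProbVec η →
      Tendsto (fun n : ℕ => (∫ ω, (numFail (fun j => ξ j ω) (n + 1) : ℝ) ∂Pfam η) / n) atTop
        (nhds 1)) ∧
    ∃ C c : ℝ, 0 < C ∧ 0 < c ∧
      ∀ (n : ℕ) (η : Fin N → ℝ), IsProbVec η →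
        |(∫ ω, (numFail (fun j => ξ j ω) (n + 1) : ℝ) ∂Pfam η) - n -
            (1 + ∑ i, η i * rvec K μ (fun i' => 1 - p i') i)| ≤ C * Real.exp (-c * n) := by
  obtain ⟨h, h0, hrec, C, c, hC, hc, hbound⟩ := exists_mean_failures_profile hK hμ hp hcrit
  have hmean : ∀ (n : ℕ) (η : Fin N → ℝ), IsProbVec η →
      ∫ ω, (numFail (fun j => ξ j ω) (n + 1) : ℝ) ∂Pfam η = ∑ i, η i * h (n + 1) i :=
    fun n η hη => by
      obtain ⟨hprob, hsite⟩ := henv η hη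
      exact hsite.integral_numFail hK hp h0 hrec (n + 1)
  have hexp : ∀ (n : ℕ) (η : Fin N → ℝ), IsProbVec η →
      |(∫ ω, (numFail (fun j => ξ j ω) (n + 1) : ℝ) ∂Pfam η) - n -
        (1 + ∑ i, η i * rvec K μ (fun i' => 1 - p i') i)| ≤ C * Real.exp (-c * n) := by
    intro n η hη
    have hsum : ∀ a : ℝ, ∑ i, η i * a = a := fun a => by rw [← Finset.sum_mul, hη.2, one_mul]
    have heq : (∑ i, η i * h (n + 1) i) - n -
        (1 + ∑ i, η i * rvec K μ (fun i' => 1 - p i') i) =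
        ∑ i, η i * (h (n + 1) i - n - (1 + rvec K μ (fun i' => 1 - p i') i)) := by
      simp only [mul_sub, mul_add, Finset.sum_sub_distrib, Finset.sum_add_distrib, hsum]
    rw [hmean n η hη, heq, ← hsum (C * Real.exp (-c * n))]
    refine (Finset.abs_sum_le_sum_abs _ _).trans (Finset.sum_le_sum fun i _ => ?_)
    rw [abs_mul, abs_of_nonneg (hη.1 i)]
    exact mul_le_mul_of_nonneg_left (hbound n i) (hη.1 i)
  refine ⟨fun η hη => ?_, C, c, hC, hc, hexp⟩
  set E : ℕ → ℝ := fun n => ∫ ω, (numFail (fun j => ξ j ω) (n + 1) : ℝ) ∂Pfam η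
  set r := 1 + ∑ i, η i * rvec K μ (fun i' => 1 - p i') i
  have hlim : Tendsto (fun n : ℕ => (C + |r|) / (n : ℝ)) atTop (nhds 0) :=
    tendsto_const_div_atTop_nhds_zero_nat _
  refine tendsto_iff_norm_sub_tendsto_zero.2
    (squeeze_zero' (Eventually.of_forall fun n => norm_nonneg _) ?_ hlim)
  filter_upwards [eventually_gt_atTop 0] with n hn
  have hn' : (0 : ℝ) < n := Nat.cast_pos.2 hn
  have h1 : E n / n - 1 = (E n - n) / n := by field_simp
  rw [h1, Real.norm_eq_abs, abs_div, abs_of_pos hn']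
  refine div_le_div_of_nonneg_right ?_ hn'.le
  have h2 : C * Real.exp (-c * n) ≤ C :=
    mul_le_of_le_one_right hC.le (Real.exp_le_one_iff.2 (by nlinarith))
  calc |E n - n| = |(E n - n - r) + r| := by rw [sub_add_cancel]
    _ ≤ |E n - n - r| + |r| := abs_add_le _ _
    _ ≤ C + |r| := by linarith [hexp n η hη]

end
end

section
/- Assume p̄ = 1/2. Then 𝐫 + 𝐫̃ = (μ·(𝐫 + 𝐫̃))𝟏; in particular, 𝐫 + 𝐫̃ is a constant multiple of the all-ones vector 𝟏. -/
open MeasureTheory Filter Set Matrix ProbabilityTheory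
open scoped Classical

noncomputable section

/-- The entrywise absolute value of an invariant row vector of a stochastic matrix is invariant. -/
lemma IsStochastic.abs_vecMul_eq {n : Type*} [Fintype n] {K : Matrix n n ℝ}
    (hK : IsStochastic K) {v : n → ℝ} (hv : v ᵥ* K = v) : |v| ᵥ* K = |v| := by
  have hle : ∀ j ∈ Finset.univ, |v| j ≤ (|v| ᵥ* K) j := fun j _ => by
    calc |v j| = |∑ i, v i * K i j| := congrArg abs (congrFun hv j).symm
      _ ≤ ∑ i, |v i * K i j| := Finset.abs_sum_le_sum_abs _ _
      _ = ∑ i, |v i| * K i j :=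
        Finset.sum_congr rfl fun i _ => by rw [abs_mul, abs_of_nonneg (hK.1 i j)]
  have hsum : ∑ j, |v| j = ∑ j, (|v| ᵥ* K) j := by
    simp only [vecMul, dotProduct]
    rw [Finset.sum_comm]
    simp [← Finset.mul_sum, hK.2]
  funext j
  exact ((Finset.sum_eq_sum_iff_of_le hle).1 hsum j (Finset.mem_univ j)).symm

/-- If the stationary distribution is unique, the only invariant row vector of total mass zero
is `0`. -/
lemma HasUniqueStationaryDist.eq_zero_of_vecMul_eq {n : Type*} [Fintype n] {K : Matrix n n ℝ}
    {μ : n → ℝ} (hK : IsStochastic K) (hμ : HasUniqueStationaryDist K μ) {v : n → ℝ}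
    (hv : v ᵥ* K = v) (hsum : ∑ i, v i = 0) : v = 0 := by
  have habs := hK.abs_vecMul_eq hv
  by_contra hne
  have hmass : ∑ i, |v i| ≠ 0 := fun h => hne <| funext fun i =>
    abs_eq_zero.1 ((Finset.sum_eq_zero_iff_of_nonneg fun i _ => abs_nonneg (v i)).1 h i
      (Finset.mem_univ i))
  have hpos : 0 ≤ (∑ i, |v i|)⁻¹ := inv_nonneg.2 (Finset.sum_nonneg fun i _ => abs_nonneg (v i))
  have h₁ : (∑ i, |v i|)⁻¹ • |v| = μ := by
    refine hμ.2 _ ⟨⟨fun i => mul_nonneg hpos (abs_nonneg (v i)), ?_⟩, ?_⟩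
    · simp [← Finset.mul_sum, hmass]
    · rw [smul_vecMul, habs]
  have h₂ : (∑ i, |v i|)⁻¹ • (|v| + v) = μ := by
    refine hμ.2 _ ⟨⟨fun i => mul_nonneg hpos ?_, ?_⟩, ?_⟩
    · have := neg_abs_le (v i)
      simp only [Pi.add_apply, Pi.abs_apply]
      linarith
    · simp [← Finset.mul_sum, Finset.sum_add_distrib, hsum, hmass]
    · rw [smul_vecMul, add_vecMul, habs, hv]
  have h₃ : |v| + v = |v| := smul_right_injective _ (inv_ne_zero hmass) (h₂.trans h₁.symm)
  exact hne (by simpa using h₃)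

/-- If the stationary distribution is unique, harmonic functions are constant. -/
lemma HasUniqueStationaryDist.eq_smul_one_of_mulVec_eq {n : Type*} [Fintype n] [DecidableEq n]
    {K : Matrix n n ℝ} {μ : n → ℝ} (hK : IsStochastic K) (hμ : HasUniqueStationaryDist K μ)
    {x : n → ℝ} (hx : K *ᵥ x = x) : x = (μ ⬝ᵥ x) • (1 : n → ℝ) := by
  have hμ1 : μ ⬝ᵥ 1 = 1 := by simpa [dotProduct] using hμ.1.1.2
  have hdet : (1 - K + vecMulVec 1 μ).det ≠ 0 := by
    intro h
    obtain ⟨v, hv0, hv⟩ := exists_vecMul_eq_zero_iff.2 h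
    rw [vecMul_add, vecMul_sub, vecMul_one, vecMul_vecMulVec] at hv
    have hv1 : v ⬝ᵥ 1 = 0 := by
      have := congrArg (· ⬝ᵥ (1 : n → ℝ)) hv
      simpa [add_dotProduct, sub_dotProduct, ← dotProduct_mulVec, hK.mulVec_one, hμ1,
        smul_dotProduct] using this
    rw [hv1, zero_smul, add_zero, sub_eq_zero] at hv
    exact hv0 (hμ.eq_zero_of_vecMul_eq hK hv.symm (by simpa [dotProduct] using hv1))
  refine sub_eq_zero.1 (eq_zero_of_mulVec_eq_zero hdet ?_)
  rw [mulVec_sub, mulVec_smul]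
  simp only [add_mulVec, sub_mulVec, one_mulVec, vecMulVec_mulVec, hK.mulVec_one, hx, hμ1]
  ext i
  simp

/-- In the critical case `𝐫` solves the Poisson equation `(I − K) 𝐫 = 2𝐩 − 𝟏`. -/
lemma HasUniqueStationaryDist.rvec_sub_mulVec {n : Type*} [Fintype n] [DecidableEq n]
    {K : Matrix n n ℝ} {μ p : n → ℝ} (hK : IsStochastic K) (hμ : HasUniqueStationaryDist K μ)
    (hcrit : μ ⬝ᵥ p = 1 / 2) :
    rvec K μ p - K *ᵥ rvec K μ p = (2 : ℝ) • p - 1 := by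
  have hμ1 : μ ⬝ᵥ 1 = 1 := by simpa [dotProduct] using hμ.1.1.2
  have hq : μ ⬝ᵥ (1 - p) = 1 / 2 := by
    rw [dotProduct_sub, hμ1, hcrit]
    norm_num
  have hfun : (fun i => 1 - p i) = 1 - p := rfl
  unfold rvec
  rw [hfun]
  set w := μ ᵥ* (Matrix.diagonal (1 - p) * K) with hw
  set A := 1 - K + (2 : ℝ) • vecMulVec (1 - p) w with hA
  have hw1 : w ⬝ᵥ 1 = 1 / 2 := by
    rw [hw, ← dotProduct_mulVec, ← mulVec_mulVec, hK.mulVec_one, ← hq]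
    congr 1
    ext i
    simp [mulVec_diagonal]
  have hAx : ∀ x, A *ᵥ x = x - K *ᵥ x + (2 * (w ⬝ᵥ x)) • (1 - p) := fun x => by
    rw [hA, add_mulVec, sub_mulVec, one_mulVec, smul_mulVec, vecMulVec_mulVec]
    ext i
    simp
    ring
  have hμA : ∀ x, μ ⬝ᵥ (A *ᵥ x) = w ⬝ᵥ x := fun x => by
    rw [hAx, dotProduct_add, dotProduct_sub, dotProduct_mulVec, hμ.1.2, dotProduct_smul, hq,
      smul_eq_mul]
    ring
  have hdet : A.det ≠ 0 := by
    intro h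
    obtain ⟨x, hx0, hx⟩ := exists_mulVec_eq_zero_iff.2 h
    have hwx : w ⬝ᵥ x = 0 := by rw [← hμA, hx, dotProduct_zero]
    have hKx : K *ᵥ x = x := by
      have := hAx x
      rw [hx, hwx, mul_zero, zero_smul, add_zero] at this
      exact (sub_eq_zero.1 this.symm).symm
    have hxc := hμ.eq_smul_one_of_mulVec_eq hK hKx
    rw [hxc, dotProduct_smul, hw1, smul_eq_mul] at hwx
    have hc : μ ⬝ᵥ x = 0 := by linarith
    exact hx0 (by rw [hxc, hc, zero_smul])
  have hs : A *ᵥ (A⁻¹ *ᵥ p) = p := by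
    rw [mulVec_mulVec, mul_nonsing_inv _ (isUnit_iff_ne_zero.2 hdet), one_mulVec]
  have hws : w ⬝ᵥ (A⁻¹ *ᵥ p) = 1 / 2 := by rw [← hμA, hs, hcrit]
  have hAs := hAx (A⁻¹ *ᵥ p)
  rw [hs, hws] at hAs
  rw [mulVec_sub, hK.mulVec_one]
  ext i
  have := congrFun hAs i
  simp only [Pi.add_apply, Pi.sub_apply, Pi.smul_apply, Pi.one_apply, smul_eq_mul] at this ⊢
  linarith

/-- **Lemma 4.4.** In the critical case `p̄ = 1/2`, `𝐫 + 𝐫̃ = (μ·(𝐫 + 𝐫̃))𝟏`; in particular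
`𝐫 + 𝐫̃` is a constant multiple of the all-ones vector (here `𝐫̃ = rvec K μ (1−p)`). -/
theorem r_plus_rtil_is_constant
    {N : ℕ} (K : Matrix (Fin N) (Fin N) ℝ) (μ p : Fin N → ℝ)
    (hK : IsStochastic K) (hμ : HasUniqueStationaryDist K μ)
    (hp : ∀ i, p i ∈ Set.Ioo (0 : ℝ) 1)
    (hcrit : ∑ i, μ i * p i = 1 / 2) :
    rvec K μ p + rvec K μ (fun i => 1 - p i) =
      (∑ i, μ i * (rvec K μ p i + rvec K μ (fun i' => 1 - p i') i)) • (1 : Fin N → ℝ) ∧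
    ∃ c : ℝ, rvec K μ p + rvec K μ (fun i => 1 - p i) = fun _ => c := by
  have hr := hμ.rvec_sub_mulVec hK hcrit
  have hrtil := hμ.rvec_sub_mulVec (p := fun i => 1 - p i) hK (by
    simp only [dotProduct, mul_sub, mul_one, Finset.sum_sub_distrib, hcrit, hμ.1.1.2]
    norm_num)
  have hharm : K *ᵥ (rvec K μ p + rvec K μ (fun i => 1 - p i)) =
      rvec K μ p + rvec K μ (fun i => 1 - p i) := by
    rw [mulVec_add]
    ext i
    have h₁ := congrFun hr i
    have h₂ := congrFun hrtil i
    simp only [Pi.add_apply, Pi.sub_apply, Pi.smul_apply, Pi.one_apply, smul_eq_mul] at h₁ h₂ ⊢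
    linarith
  have hconst := hμ.eq_smul_one_of_mulVec_eq hK hharm
  refine ⟨hconst, μ ⬝ᵥ (rvec K μ p + rvec K μ (fun i => 1 - p i)), hconst.trans ?_⟩
  ext i
  simp only [Pi.smul_apply, Pi.one_apply, smul_eq_mul, mul_one]

end
end
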